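/- arXiv:2106.01524 — 2 statements merged into one kernel-verified Lean document; each statement's English description precedes it below -/
import Mathlib

section
/- Let K be a Euclidean cubical complex in ℝⁿ with a minimum vertex w, and let L = R(K, w) be the reachable complex from w. Let τ, σ be cubes of L with τ a free face of σ in L such that (τ, σ) is an LPDC pair in L, and let L' be the (τ, σ)-collapse of L. Then the dipath space P(L, w, v) is connected for every vertex v of L if and only if the dipath space P(L', w, v) is connected for every vertex v of L'. -/
open Set

namespace DCC

/-- The real point corresponding to an integer point of `ℤⁿ`. -/
def toR {n : ℕ} (v : Fin n → ℤ) : Fin n → ℝ := fun i => (v i : ℝ)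

/-- `j ∈ {0,1}ⁿ`: every coordinate of `j` is `0` or `1`. -/
def IsBinary {n : ℕ} (j : Fin n → ℤ) : Prop := ∀ i, j i = 0 ∨ j i = 1

/-- The elementary cube `[v - j, v] = {x : v - j ⪯ x ⪯ v}` in `ℝⁿ`. -/
def cube {n : ℕ} (v j : Fin n → ℤ) : Set (Fin n → ℝ) := Set.Icc (toR (v - j)) (toR v)

/-- A subset of `ℝⁿ` which is an elementary cube. -/
def IsElemCube {n : ℕ} (σ : Set (Fin n → ℝ)) : Prop := ∃ v j, IsBinary j ∧ σ = cube v j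

/-- A Euclidean cubical complex: a finite union of elementary cubes. -/
def IsComplex {n : ℕ} (K : Set (Fin n → ℝ)) : Prop :=
  ∃ C : Finset ((Fin n → ℤ) × (Fin n → ℤ)),
    (∀ c ∈ C, IsBinary c.2) ∧ K = ⋃ c ∈ C, cube c.1 c.2

/-- The past link of `v` in `K`: all nonzero binary `j` with `[v - j, v] ⊆ K`. -/
def pastlk {n : ℕ} (K : Set (Fin n → ℝ)) (v : Fin n → ℤ) : Set (Fin n → ℤ) :=
  {j | IsBinary j ∧ j ≠ 0 ∧ cube v j ⊆ K}

/-- A maximal cube of `K`: a cube of `K` not properly contained in another cube of `K`. -/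
def IsMaximalCube {n : ℕ} (K σ : Set (Fin n → ℝ)) : Prop :=
  IsElemCube σ ∧ σ ⊆ K ∧ ∀ γ, IsElemCube γ → γ ⊆ K → σ ⊆ γ → γ = σ

/-- `τ` is a free face of the maximal cube `σ` in `K`: `τ` is a proper face of `σ` and
`σ` is the unique maximal cube of `K` containing `τ`. -/
def IsFreeFace {n : ℕ} (K τ σ : Set (Fin n → ℝ)) : Prop :=
  IsElemCube τ ∧ τ ⊂ σ ∧ IsMaximalCube K σ ∧
    ∀ γ, IsMaximalCube K γ → τ ⊆ γ → γ = σ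

/-- The `(τ, σ)`-collapse of `K`: the union of all cubes of `K` that do not contain `τ`. -/
def collapse {n : ℕ} (K τ : Set (Fin n → ℝ)) : Set (Fin n → ℝ) :=
  ⋃₀ {γ | IsElemCube γ ∧ γ ⊆ K ∧ ¬ τ ⊆ γ}

/-- The restriction `K|_σ` where `σ` has minimum vertex `a` and maximum vertex `b`:
the union of all cubes `γ` of `K` with `a ⪯ min γ` and `max γ ⪯ b`. -/
def restrict {n : ℕ} (K : Set (Fin n → ℝ)) (a b : Fin n → ℤ) : Set (Fin n → ℝ) :=
  ⋃₀ {γ | ∃ v j, IsBinary j ∧ γ = cube v j ∧ cube v j ⊆ K ∧ a ≤ v - j ∧ v ≤ b}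

/-- The geometric realization of the past link of `v` in `K`, as a subset of `ℝⁿ`:
the union over `j ∈ pastlk K v` of the convex hulls of `{v - eᵢ : jᵢ = 1}`. -/
def geomReal {n : ℕ} (K : Set (Fin n → ℝ)) (v : Fin n → ℤ) : Set (Fin n → ℝ) :=
  ⋃ j ∈ pastlk K v, convexHull ℝ ((fun i => toR v - Pi.single i (1 : ℝ)) '' {i | j i = 1})

/-- The space of dipaths in `K` from `p` to `q`, as a subspace of
`C([0,1], ℝⁿ)` with the compact-open topology. -/
def DipathSpace {n : ℕ} (K : Set (Fin n → ℝ)) (p q : Fin n → ℝ) :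
    Set C(unitInterval, Fin n → ℝ) :=
  {γ | (∀ t, γ t ∈ K) ∧ γ 0 = p ∧ γ 1 = q ∧ Monotone ⇑γ}

/-- The reachable complex `R(K, p)`: points of `K` reachable from `p` by a dipath in `K`. -/
def reach {n : ℕ} (K : Set (Fin n → ℝ)) (p : Fin n → ℝ) : Set (Fin n → ℝ) :=
  {q ∈ K | (DipathSpace K p q).Nonempty}

/-- `(τ, σ)` is an LPDC pair in `K` (where `K'` is the `(τ,σ)`-collapse of `K`):
for every vertex `v` of `K'`, the geometric realizations of the past links of `v`
in `K` and in `K'` are homotopy equivalent. -/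
def IsLPDCPair {n : ℕ} (K τ : Set (Fin n → ℝ)) : Prop :=
  ∀ v : Fin n → ℤ, toR v ∈ collapse K τ →
    Nonempty (ContinuousMap.HomotopyEquiv ↥(geomReal K v) ↥(geomReal (collapse K τ) v))


/-! ### Helper lemmas -/

noncomputable def fl {n : ℕ} (x : Fin n → ℝ) : Fin n → ℤ := fun i => ⌊x i⌋
noncomputable def ce {n : ℕ} (x : Fin n → ℝ) : Fin n → ℤ := fun i => ⌈x i⌉

/-- `K` contains the minimal elementary cube around each of its points. -/
def Cub {n : ℕ} (K : Set (Fin n → ℝ)) : Prop :=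
  ∀ x ∈ K, Set.Icc (toR (fl x)) (toR (ce x)) ⊆ K

def Rel {X : Type*} [TopologicalSpace X] (P : Set X) (a b : X) : Prop :=
  ∃ S ⊆ P, a ∈ S ∧ b ∈ S ∧ IsPreconnected S

theorem Rel.symm {X : Type*} [TopologicalSpace X] {P : Set X} {a b : X} (h : Rel P a b) :
    Rel P b a := by
  obtain ⟨S, h1, h2, h3, h4⟩ := h
  exact ⟨S, h1, h3, h2, h4⟩

theorem Rel.trans {X : Type*} [TopologicalSpace X] {P : Set X} {a b c : X} (h : Rel P a b)
    (h' : Rel P b c) : Rel P a c := by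
  obtain ⟨S, h1, h2, h3, h4⟩ := h
  obtain ⟨T, g1, g2, g3, g4⟩ := h'
  exact ⟨S ∪ T, union_subset h1 g1, Or.inl h2, Or.inr g3, IsPreconnected.union b h3 g2 h4 g4⟩

theorem rel_of_homotopy {n : ℕ} {P : Set C(unitInterval, Fin n → ℝ)}
    (F : C(unitInterval × unitInterval, Fin n → ℝ)) (h : ∀ s, F.curry s ∈ P) :
    Rel P (F.curry 0) (F.curry 1) := by
  refine ⟨Set.range F.curry, ?_, ⟨0, rfl⟩, ⟨1, rfl⟩, ?_⟩
  · rintro _ ⟨s, rfl⟩; exact h s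
  · exact isPreconnected_range F.curry.continuous

/-- Combinatorial connectedness of the past link. -/
def Conn {n : ℕ} (K : Set (Fin n → ℝ)) (v : Fin n → ℤ) : Prop :=
  ∀ A : Set (Fin n), ∀ i ∈ A, ∀ k ∉ A, Pi.single i 1 ∈ pastlk K v → Pi.single k 1 ∈ pastlk K v →
    ∃ J ∈ pastlk K v, ∃ i ∈ A, ∃ k ∉ A, J i = 1 ∧ J k = 1

theorem isBinary_single {n : ℕ} (i : Fin n) : IsBinary (Pi.single i (1 : ℤ)) := by
  intro l
  by_cases h : l = i
  · subst h; simp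
  · simp [h]

theorem single_mem_pastlk {n : ℕ} {K : Set (Fin n → ℝ)} {v J : Fin n → ℤ} (hJ : J ∈ pastlk K v)
    {i : Fin n} (hi : J i = 1) : Pi.single i 1 ∈ pastlk K v := by
  refine ⟨isBinary_single i, by simp, subset_trans ?_ hJ.2.2⟩
  apply Set.Icc_subset_Icc_left
  intro l
  simp only [toR, Pi.sub_apply]
  by_cases h : l = i
  · subst h; simp [hi]
  · have := hJ.1 l
    simp only [Pi.single_eq_of_ne h]
    rcases this with h | h <;> simp [h]

theorem exists_one {n : ℕ} {K : Set (Fin n → ℝ)} {v J : Fin n → ℤ} (hJ : J ∈ pastlk K v) :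
    ∃ i, J i = 1 := by
  by_contra! h
  exact hJ.2.1 (funext fun i => (hJ.1 i).resolve_right (h i))

/-- A point of `K` close below `v` determines a simplex of the past link. -/
theorem near {n : ℕ} {K : Set (Fin n → ℝ)} (hK : Cub K) {v : Fin n → ℤ} {x : Fin n → ℝ}
    (hx : x ∈ K) (hxv : x ≤ toR v) (hlt : ∀ l, (v l : ℝ) - 1 < x l) :
    IsBinary (fun l => if x l < v l then (1 : ℤ) else 0) ∧
      cube v (fun l => if x l < v l then (1 : ℤ) else 0) ⊆ K := by
  refine ⟨fun l => ?_, subset_trans ?_ (hK x hx)⟩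
  · by_cases h : x l < v l <;> simp [h]
  · apply Set.Icc_subset_Icc
    · intro l
      simp only [toR, fl, Pi.sub_apply]
      by_cases h : x l < v l
      · simp only [h, if_true]
        have : ⌊x l⌋ < v l := Int.floor_lt.2 h
        exact_mod_cast (by omega : ⌊x l⌋ ≤ v l - 1)
      · simp only [h, if_false]
        have h1 : x l ≤ v l := hxv l
        have : x l = v l := le_antisymm h1 (not_lt.1 h)
        rw [this]; simp
    · intro l
      simp only [toR, ce]
      have : v l - 1 < ⌈x l⌉ := Int.lt_ceil.2 (by have := hlt l; push_cast; exact this)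
      exact_mod_cast (by omega : v l ≤ ⌈x l⌉)

theorem near_mem {n : ℕ} {K : Set (Fin n → ℝ)} (hK : Cub K) {v : Fin n → ℤ} {x : Fin n → ℝ}
    (hx : x ∈ K) (hxv : x ≤ toR v) (hlt : ∀ l, (v l : ℝ) - 1 < x l) {i : Fin n} (hi : x i < v i) :
    (fun l => if x l < v l then (1 : ℤ) else 0) ∈ pastlk K v := by
  obtain ⟨h1, h2⟩ := near hK hx hxv hlt
  refine ⟨h1, fun h => ?_, h2⟩
  have := congrFun h i
  simp [hi] at this

/-- Reparametrization `t ↦ min (2t) 1`. -/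
noncomputable def rep : C(unitInterval, unitInterval) :=
  ⟨fun t => Set.projIcc 0 1 zero_le_one (min (2 * (t : ℝ)) 1), by fun_prop⟩

theorem rep_coe (t : unitInterval) : ((rep t : unitInterval) : ℝ) = min (2 * (t : ℝ)) 1 := by
  have h0 : (0 : ℝ) ≤ min (2 * (t : ℝ)) 1 := le_min (by have := t.2.1; linarith) zero_le_one
  have h1 : min (2 * (t : ℝ)) 1 ≤ 1 := min_le_right _ _
  simp only [rep, ContinuousMap.coe_mk, Set.projIcc_of_mem zero_le_one ⟨h0, h1⟩]

/-- Extend a path by a straight segment in direction `c`. -/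
noncomputable def ext {n : ℕ} (c : Fin n → ℝ) (β : C(unitInterval, Fin n → ℝ)) :
    C(unitInterval, Fin n → ℝ) :=
  β.comp rep + ⟨fun t => max 0 (2 * (t : ℝ) - 1) • c, by fun_prop⟩

theorem ext_apply {n : ℕ} (c : Fin n → ℝ) (β : C(unitInterval, Fin n → ℝ)) (t : unitInterval) :
    ext c β t = β (rep t) + max 0 (2 * (t : ℝ) - 1) • c := rfl

theorem continuous_ext {n : ℕ} (c : Fin n → ℝ) : Continuous (ext c) := by
  unfold ext
  exact (ContinuousMap.continuous_precomp rep).add continuous_const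

theorem rep_zero : rep 0 = 0 := Subtype.ext (by rw [rep_coe]; simp)
theorem rep_one : rep 1 = 1 := Subtype.ext (by rw [rep_coe]; simp)
theorem rep_big {t : unitInterval} (h : (1 / 2 : ℝ) ≤ t) : rep t = 1 :=
  Subtype.ext (by rw [rep_coe]; simp; linarith)
theorem rep_mono : Monotone rep := fun s t h => by
  rw [← Subtype.coe_le_coe, rep_coe, rep_coe]
  have : (s : ℝ) ≤ t := h
  gcongr

theorem ext_mem {n : ℕ} {K : Set (Fin n → ℝ)} {p u c q : Fin n → ℝ} (hc : 0 ≤ c)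
    (hq : u + c = q) (hcube : Set.Icc u q ⊆ K) {β : C(unitInterval, Fin n → ℝ)}
    (hβ : β ∈ DipathSpace K p u) : ext c β ∈ DipathSpace K p q := by
  obtain ⟨h1, h2, h3, h4⟩ := hβ
  subst hq
  refine ⟨fun t => ?_, ?_, ?_, ?_⟩
  · rw [ext_apply]
    by_cases h : (1 / 2 : ℝ) ≤ t
    · rw [rep_big h, h3]
      apply hcube
      have ht : (t : ℝ) ≤ 1 := t.2.2
      constructor
      · exact le_add_of_nonneg_right (smul_nonneg (le_max_left _ _) hc)
      · gcongr
        intro l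
        have := hc l
        simp only [Pi.smul_apply, smul_eq_mul]
        exact mul_le_of_le_one_left this (max_le zero_le_one (by linarith))
    · have : max 0 (2 * (t : ℝ) - 1) = 0 := max_eq_left (by linarith)
      rw [this]; simpa using h1 _
  · rw [ext_apply, rep_zero, h2]; simp
  · rw [ext_apply, rep_one, h3]; norm_num
  · intro s t hst
    rw [ext_apply, ext_apply]
    have hst' : (s : ℝ) ≤ t := hst
    refine add_le_add (h4 (rep_mono hst)) ?_
    exact smul_le_smul_of_nonneg_right (by gcongr) hc

theorem toR_sub_add {n : ℕ} (v J : Fin n → ℤ) : toR (v - J) + toR J = toR v := by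
  ext l; simp [toR]

theorem toR_nonneg {n : ℕ} {J : Fin n → ℤ} (h : IsBinary J) : 0 ≤ toR J := by
  intro l; rcases h l with h | h <;> simp [toR, h]

theorem ext_mem' {n : ℕ} {K : Set (Fin n → ℝ)} {p : Fin n → ℝ} {v J : Fin n → ℤ}
    (hJ : IsBinary J) (hc : cube v J ⊆ K) {β : C(unitInterval, Fin n → ℝ)}
    (hβ : β ∈ DipathSpace K p (toR (v - J))) : ext (toR J) β ∈ DipathSpace K p (toR v) :=
  ext_mem (toR_nonneg hJ) (toR_sub_add v J) hc hβ

theorem path_le {n : ℕ} {K : Set (Fin n → ℝ)} {p q : Fin n → ℝ} {γ : C(unitInterval, Fin n → ℝ)}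
    (h : γ ∈ DipathSpace K p q) (t : unitInterval) : γ t ≤ q := by
  rw [← h.2.2.1]; exact h.2.2.2 t.2.2

theorem le_path {n : ℕ} {K : Set (Fin n → ℝ)} {p q : Fin n → ℝ} {γ : C(unitInterval, Fin n → ℝ)}
    (h : γ ∈ DipathSpace K p q) (t : unitInterval) : p ≤ γ t := by
  rw [← h.2.1]; exact h.2.2.2 t.2.1

theorem toR_mono {n : ℕ} {v u : Fin n → ℤ} (h : v ≤ u) : toR v ≤ toR u := fun l => by
  simpa [toR] using h l

theorem le_of_toR {n : ℕ} {v u : Fin n → ℤ} (h : toR v ≤ toR u) : v ≤ u := fun l => by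
  simpa [toR] using h l

theorem bot_mem {n : ℕ} {K : Set (Fin n → ℝ)} {v J : Fin n → ℤ}
    (hJ : J ∈ pastlk K v) : toR (v - J) ∈ K := by
  apply hJ.2.2
  refine ⟨le_rfl, ?_⟩
  rw [← toR_sub_add v J]
  exact le_add_of_nonneg_right (toR_nonneg hJ.1)

/-- A dipath from `w` to `v ≠ w` has a time close to `v`. -/
theorem exists_near {n : ℕ} {K : Set (Fin n → ℝ)} {w v : Fin n → ℤ} (hne : w ≠ v)
    {γ : C(unitInterval, Fin n → ℝ)} (h : γ ∈ DipathSpace K (toR w) (toR v)) :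
    ∃ t, (∀ l, (v l : ℝ) - 1 < γ t l) ∧ ∃ l, γ t l < v l := by
  let g : unitInterval → ℝ := fun t => ∑ l, ((v l : ℝ) - γ t l)
  have hg : Continuous g := by fun_prop
  have hwv : w ≤ v := le_of_toR (by rw [← h.2.1]; exact path_le h 0)
  have g1 : g 1 = 0 := by simp [g, h.2.2.1, toR]
  have g0 : 1 ≤ g 0 := by
    obtain ⟨l, hl⟩ : ∃ l, w l ≠ v l := Function.ne_iff.1 hne
    have e : g 0 = ((∑ l, (v l - w l) : ℤ) : ℝ) := by simp [g, h.2.1, toR]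
    rw [e]
    have : v l - w l ≤ ∑ l, (v l - w l) :=
      Finset.single_le_sum (f := fun l => v l - w l) (fun l _ => sub_nonneg.2 (hwv l))
        (Finset.mem_univ l)
    have : w l ≤ v l := hwv l
    exact_mod_cast (by omega : (1 : ℤ) ≤ ∑ l, (v l - w l))
  obtain ⟨t, ht⟩ : (1 / 2 : ℝ) ∈ Set.range g :=
    mem_range_of_exists_le_of_exists_ge hg ⟨1, by rw [g1]; norm_num⟩ ⟨0, by linarith⟩
  have hnn : ∀ l, 0 ≤ (v l : ℝ) - γ t l := fun l => sub_nonneg.2 (path_le h t l)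
  refine ⟨t, fun l => ?_, ?_⟩
  · have : (v l : ℝ) - γ t l ≤ g t :=
      Finset.single_le_sum (f := fun l => (v l : ℝ) - γ t l) (fun l _ => hnn l)
        (Finset.mem_univ l)
    linarith
  · by_contra! hcon
    have : g t ≤ 0 := Finset.sum_nonpos fun l _ => sub_nonpos.2 (hcon l)
    linarith

theorem exists_pastlk {n : ℕ} {K : Set (Fin n → ℝ)} (hK : Cub K) {w v : Fin n → ℤ} (hne : w ≠ v)
    (h : (DipathSpace K (toR w) (toR v)).Nonempty) : ∃ J, J ∈ pastlk K v := by
  obtain ⟨γ, h⟩ := h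
  obtain ⟨t, h1, l, h2⟩ := exists_near hne h
  exact ⟨_, near_mem hK (h.1 t) (path_le h t) h1 h2⟩

/-- If dipath spaces are connected, the past links are connected. -/
theorem conn_of_preconn {n : ℕ} {K : Set (Fin n → ℝ)} (hK : Cub K) {w : Fin n → ℤ}
    (hmin : ∀ q ∈ K, toR w ≤ q)
    (hreach : ∀ v : Fin n → ℤ, toR v ∈ K → (DipathSpace K (toR w) (toR v)).Nonempty)
    {v : Fin n → ℤ} (hP : IsPreconnected (DipathSpace K (toR w) (toR v))) : Conn K v := by
  intro A i hi k hk hip hkp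
  let U : Set (Fin n) → Set C(unitInterval, Fin n → ℝ) := fun B =>
    {γ | ∃ t, (∀ l, (v l : ℝ) - 1 < γ t l) ∧ ∃ l ∈ B, γ t l < v l}
  have hopen : ∀ B, IsOpen (U B) := by
    intro B
    have : U B = ⋃ t : unitInterval, ((⋂ l, {γ : C(unitInterval, Fin n → ℝ) | (v l : ℝ) - 1 < γ t l}) ∩
        ⋃ l ∈ B, {γ : C(unitInterval, Fin n → ℝ) | γ t l < v l}) := by
      ext γ; simp [U]
    rw [this]
    have hc : ∀ (t : unitInterval) (l : Fin n),
        Continuous fun γ : C(unitInterval, Fin n → ℝ) => γ t l := fun t l =>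
      (continuous_apply l).comp (continuous_eval_const t)
    refine isOpen_iUnion fun t => IsOpen.inter (isOpen_iInter_of_finite fun l => ?_)
      (isOpen_biUnion fun l _ => ?_)
    · exact isOpen_lt continuous_const (hc t l)
    · exact isOpen_lt (hc t l) continuous_const
  have hne : w ≠ v := by
    rintro rfl
    have := hmin _ (bot_mem hip) i
    simp [toR] at this
    linarith
  have hmeet : ∀ (B : Set (Fin n)) (m : Fin n), m ∈ B → Pi.single m 1 ∈ pastlk K v →
      (DipathSpace K (toR w) (toR v) ∩ U B).Nonempty := by
    intro B m hm hmp
    obtain ⟨β, hβ⟩ := hreach _ (bot_mem hmp)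
    refine ⟨_, ext_mem' hmp.1 hmp.2.2 hβ, ?_⟩
    refine ⟨⟨3 / 4, by norm_num, by norm_num⟩, fun l => ?_, m, hm, ?_⟩
    · rw [ext_apply, rep_big (by norm_num), hβ.2.2.1]
      by_cases h : l = m
      · subst h; simp [toR]; norm_num
      · simp [toR, h]
    · rw [ext_apply, rep_big (by norm_num), hβ.2.2.1]
      simp [toR]; norm_num; linarith
  obtain ⟨γ, hγ, ⟨t, ht, a, ha, hta⟩, ⟨t', ht', b, hb, htb⟩⟩ :=
    hP (U A) (U Aᶜ) (hopen A) (hopen Aᶜ) (by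
      intro γ hγ
      obtain ⟨t, h1, l, h2⟩ := exists_near hne hγ
      by_cases hl : l ∈ A
      · exact Or.inl ⟨t, h1, l, hl, h2⟩
      · exact Or.inr ⟨t, h1, l, hl, h2⟩) (hmeet A i hi hip) (hmeet Aᶜ k hk hkp)
  have hs : ∀ l, (v l : ℝ) - 1 < γ (min t t') l := by
    rcases min_choice t t' with h | h <;> rw [h] <;> assumption
  have hsa : γ (min t t') a < v a := lt_of_le_of_lt (hγ.2.2.2 (min_le_left t t') a) hta
  have hsb : γ (min t t') b < v b := lt_of_le_of_lt (hγ.2.2.2 (min_le_right t t') b) htb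
  exact ⟨_, near_mem hK (hγ.1 _) (path_le hγ _) hs hsa, a, ha, b, hb, by simp [hsa], by simp [hsb]⟩

/-- Lowering one coordinate below `v i`. -/
theorem lower_mem {n : ℕ} {K : Set (Fin n → ℝ)} (hK : Cub K) {v : Fin n → ℤ} {x y : Fin n → ℝ}
    (hx : x ∈ K) (hxv : x ≤ toR v) (hlt : ∀ l, (v l : ℝ) - 1 < x l) {i : Fin n} (hi : x i < v i)
    (hy : y ∈ K) (hyv : y ≤ toR v) (hcmp : x ≤ y ∨ y ≤ x) {lam : ℝ} (h0 : 0 ≤ lam) (h1 : lam ≤ 1) :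
    (fun l => min (y l) (v l - lam * (if l = i then 1 else 0))) ∈ K := by
  rcases hcmp with h | h
  · obtain ⟨h2, h3⟩ := near hK hx hxv hlt
    apply h3
    constructor
    · intro l
      simp only [toR, Pi.sub_apply]
      by_cases hl : l = i
      · subst hl
        have := hlt l
        have := h l
        simp only [hi, if_true]
        push_cast
        refine le_min ?_ ?_ <;> linarith
      · simp only [hl, if_false, mul_zero, sub_zero]
        have h5 := hlt l
        have h4 := h l
        have h7 : x l ≤ v l := hxv l
        by_cases h6 : x l < v l
        · simp only [h6, if_true]; push_cast
          refine le_min ?_ ?_ <;> linarith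
        · simp only [h6, if_false]; push_cast
          refine le_min ?_ ?_ <;> linarith
    · intro l
      exact (min_le_left _ _).trans (hyv l)
  · apply hK y hy
    constructor
    · intro l
      simp only [toR, fl]
      refine le_min (Int.floor_le _) ?_
      by_cases hl : l = i
      · subst hl
        have : ⌊y l⌋ < v l := Int.floor_lt.2 (lt_of_le_of_lt (h l) hi)
        have : (⌊y l⌋ : ℝ) ≤ v l - 1 := by exact_mod_cast (by omega : ⌊y l⌋ ≤ v l - 1)
        simp only [if_true]; linarith
      · simp only [hl, if_false, mul_zero, sub_zero]
        exact (Int.floor_le _).trans (hyv l)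
    · intro l
      exact (min_le_left _ _).trans (Int.le_ceil _)

/-- The homotopy pushing a dipath so that it ends with the edge in direction `i`. -/
noncomputable def push {n : ℕ} (γ : C(unitInterval, Fin n → ℝ)) (v : Fin n → ℤ) (i : Fin n) :
    C(unitInterval × unitInterval, Fin n → ℝ) :=
  ⟨fun st l => min (γ (Set.projIcc 0 1 zero_le_one
      ((1 - (st.1 : ℝ)) * st.2 + st.1 * min (2 * (st.2 : ℝ)) 1)) l)
    (v l - (st.1 * min 1 (2 - 2 * (st.2 : ℝ))) * (if l = i then 1 else 0)), by fun_prop⟩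

theorem step {n : ℕ} {K : Set (Fin n → ℝ)} (hK : Cub K) {w : Fin n → ℤ}
    (hmin : ∀ q ∈ K, toR w ≤ q) {v : Fin n → ℤ} {γ : C(unitInterval, Fin n → ℝ)}
    (hγ : γ ∈ DipathSpace K (toR w) (toR v)) {i : Fin n} {t₀ : unitInterval}
    (hlt : ∀ l, (v l : ℝ) - 1 < γ t₀ l) (hi : γ t₀ i < v i) :
    ∃ H ∈ DipathSpace K (toR w) (toR (v - Pi.single i 1)),
      Rel (DipathSpace K (toR w) (toR v)) γ (ext (toR (Pi.single i 1)) H) := by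
  have hpl := near_mem hK (hγ.1 t₀) (path_le hγ t₀) hlt hi
  have hip : Pi.single i 1 ∈ pastlk K v := single_mem_pastlk hpl (by simp [hi])
  have hw : ∀ l, (w l : ℝ) ≤ v l - (if l = i then 1 else 0) := by
    intro l
    have := hmin _ (bot_mem hip) l
    simp only [toR, Pi.sub_apply, Pi.single_apply] at this
    exact_mod_cast this
  have hcmp : ∀ t, γ t₀ ≤ γ t ∨ γ t ≤ γ t₀ := fun t =>
    (le_total t₀ t).imp (fun h => hγ.2.2.2 h) (fun h => hγ.2.2.2 h)
  have hlow : ∀ t (lam : ℝ), 0 ≤ lam → lam ≤ 1 →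
      (fun l => min (γ t l) (v l - lam * (if l = i then 1 else 0))) ∈ K := fun t lam h0 h1 =>
    lower_mem hK (hγ.1 t₀) (path_le hγ t₀) hlt hi (hγ.1 t) (path_le hγ t) (hcmp t) h0 h1
  let H : C(unitInterval, Fin n → ℝ) :=
    ⟨fun t l => min (γ t l) (v l - 1 * (if l = i then 1 else 0)), by fun_prop⟩
  have hH : ∀ t l, H t l = min (γ t l) (v l - 1 * (if l = i then 1 else 0)) := fun _ _ => rfl
  refine ⟨H, ⟨fun t => hlow t 1 zero_le_one le_rfl, ?_, ?_, ?_⟩, ?_⟩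
  · ext l
    rw [hH, hγ.2.1, one_mul]
    exact min_eq_left (hw l)
  · ext l
    rw [hH, hγ.2.2.1, one_mul]
    simp only [toR, Pi.sub_apply, Pi.single_apply]
    push_cast
    apply min_eq_right
    split_ifs <;> linarith
  · intro s t hst l
    rw [hH, hH]
    exact min_le_min_right _ (hγ.2.2.2 hst l)
  · have happ : ∀ s t l, (push γ v i).curry s t l = min (γ (Set.projIcc 0 1 zero_le_one
      ((1 - (s : ℝ)) * t + s * min (2 * (t : ℝ)) 1)) l)
      (v l - (s * min 1 (2 - 2 * (t : ℝ))) * (if l = i then 1 else 0)) := fun _ _ _ => rfl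
    have key := rel_of_homotopy (P := DipathSpace K (toR w) (toR v)) (push γ v i) (by
      intro s
      have s0 : (0 : ℝ) ≤ s := s.2.1
      have s1 : (s : ℝ) ≤ 1 := s.2.2
      refine ⟨fun t => ?_, ?_, ?_, ?_⟩
      · have t0 : (0 : ℝ) ≤ t := t.2.1
        have t1 : (t : ℝ) ≤ 1 := t.2.2
        have m0 : 0 ≤ min 1 (2 - 2 * (t : ℝ)) := le_min zero_le_one (by linarith)
        exact hlow _ _ (mul_nonneg s0 m0) (mul_le_one₀ s1 m0 (min_le_left _ _))
      · ext l
        rw [happ]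
        have : Set.projIcc (0 : ℝ) 1 zero_le_one ((1 - (s : ℝ)) * ((0 : unitInterval) : ℝ) +
            s * min (2 * ((0 : unitInterval) : ℝ)) 1) = 0 :=
          Set.projIcc_of_le_left _ (by simp)
        rw [this, hγ.2.1]
        apply min_eq_left
        refine (hw l).trans ?_
        simp only [Set.Icc.coe_zero]
        split_ifs
        · norm_num; linarith
        · simp
      · ext l
        rw [happ]
        have : Set.projIcc (0 : ℝ) 1 zero_le_one ((1 - (s : ℝ)) * ((1 : unitInterval) : ℝ) +
            s * min (2 * ((1 : unitInterval) : ℝ)) 1) = 1 :=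
          Set.projIcc_of_right_le _ (by simp)
        rw [this, hγ.2.2.1]
        simp [toR]
      · intro a b hab l
        have hab' : (a : ℝ) ≤ b := hab
        rw [happ, happ]
        refine min_le_min ?_ ?_
        · apply hγ.2.2.2
          apply Set.monotone_projIcc
          have : (0 : ℝ) ≤ 1 - s := by linarith
          gcongr
        · gcongr)
    have e0 : (push γ v i).curry 0 = γ := by
      ext t l
      rw [happ]
      simp only [Set.Icc.coe_zero, sub_zero, one_mul, zero_mul, add_zero, Set.projIcc_val]
      exact min_eq_left (path_le hγ t l)
    have e1 : (push γ v i).curry 1 = ext (toR (Pi.single i 1)) H := by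
      ext t l
      rw [happ, ext_apply]
      have : Set.projIcc (0 : ℝ) 1 zero_le_one ((1 - ((1 : unitInterval) : ℝ)) * t +
          ((1 : unitInterval) : ℝ) * min (2 * (t : ℝ)) 1) = rep t := by
        simp [rep]
      rw [this]
      simp only [Pi.add_apply, Pi.smul_apply, hH, smul_eq_mul, toR, Pi.single_apply,
        Set.Icc.coe_one, one_mul]
      by_cases ht : (1 / 2 : ℝ) ≤ t
      · rw [rep_big ht, hγ.2.2.1, max_eq_right (by linarith), min_eq_right (by linarith : 2 - 2 * (t : ℝ) ≤ 1)]
        have t1 : (t : ℝ) ≤ 1 := t.2.2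
        simp only [toR]
        split_ifs
        · push_cast
          rw [min_eq_right (by linarith), min_eq_right (by linarith)]; ring
        · simp
      · rw [max_eq_left (by linarith), min_eq_left (by linarith : 1 ≤ 2 - 2 * (t : ℝ))]
        simp
    rwa [e0, e1] at key

/-- If the past links are connected, then so are the dipath spaces. -/
theorem preconn_of_conn {n : ℕ} {K : Set (Fin n → ℝ)} (hK : Cub K) {w : Fin n → ℤ}
    (hmin : ∀ q ∈ K, toR w ≤ q)
    (hreach : ∀ v : Fin n → ℤ, toR v ∈ K → (DipathSpace K (toR w) (toR v)).Nonempty)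
    (hconn : ∀ v : Fin n → ℤ, toR v ∈ K → Conn K v) (N : ℕ) :
    ∀ v : Fin n → ℤ, toR v ∈ K → ∑ l, (v l - w l) ≤ N →
      IsPreconnected (DipathSpace K (toR w) (toR v)) := by
  induction N with
  | zero =>
    intro v hv hN
    have hwv : w ≤ v := le_of_toR (hmin _ hv)
    have : w = v := by
      ext l
      have h1 : v l - w l ≤ ∑ l, (v l - w l) :=
        Finset.single_le_sum (f := fun l => v l - w l) (fun l _ => sub_nonneg.2 (hwv l))
          (Finset.mem_univ l)
      have : w l ≤ v l := hwv l
      push_cast at hN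
      omega
    subst this
    apply Set.Subsingleton.isPreconnected
    intro a ha b hb
    ext t : 1
    exact (le_antisymm (path_le ha t) (le_path ha t)).trans
      (le_antisymm (path_le hb t) (le_path hb t)).symm
  | succ N ih =>
    intro v hv hN
    by_cases hne : w = v
    · subst hne
      exact ih _ hv (by simp)
    set P := DipathSpace K (toR w) (toR v) with hPdef
    have hpre : ∀ i, Pi.single i 1 ∈ pastlk K v →
        IsPreconnected (DipathSpace K (toR w) (toR (v - Pi.single i 1))) := by
      intro i hi
      refine ih _ (bot_mem hi) ?_
      have : ∑ l, ((v - Pi.single i 1 : Fin n → ℤ) l - w l) = ∑ l, (v l - w l) - 1 := by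
        simp [Finset.sum_sub_distrib, Pi.single_apply]; ring
      rw [this]; push_cast at hN; omega
    have hrel : ∀ i, Pi.single i 1 ∈ pastlk K v →
        ∀ α ∈ DipathSpace K (toR w) (toR (v - Pi.single i 1)),
        ∀ β ∈ DipathSpace K (toR w) (toR (v - Pi.single i 1)),
        Rel P (ext (toR (Pi.single i 1)) α) (ext (toR (Pi.single i 1)) β) := by
      intro i hi α hα β hβ
      refine ⟨ext (toR (Pi.single i 1)) '' _, ?_, ⟨α, hα, rfl⟩, ⟨β, hβ, rfl⟩,
        (hpre i hi).image _ (continuous_ext _).continuousOn⟩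
      rintro _ ⟨δ, hδ, rfl⟩
      exact ext_mem' hi.1 hi.2.2 hδ
    -- for each `γ` some direction
    have htype : ∀ γ ∈ P, ∃ i, Pi.single i 1 ∈ pastlk K v ∧
        ∃ H ∈ DipathSpace K (toR w) (toR (v - Pi.single i 1)),
          Rel P γ (ext (toR (Pi.single i 1)) H) := by
      intro γ hγ
      obtain ⟨t, h1, i, h2⟩ := exists_near hne hγ
      refine ⟨i, single_mem_pastlk (near_mem hK (hγ.1 t) (path_le hγ t) h1 h2) (by simp [h2]), ?_⟩
      exact step hK hmin hγ h1 h2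
    have hcross : ∀ J ∈ pastlk K v, ∃ δ ∈ P, ∀ i, J i = 1 →
        ∃ H ∈ DipathSpace K (toR w) (toR (v - Pi.single i 1)),
          Rel P δ (ext (toR (Pi.single i 1)) H) := by
      intro J hJ
      obtain ⟨β, hβ⟩ := hreach _ (bot_mem hJ)
      refine ⟨_, ext_mem' hJ.1 hJ.2.2 hβ, fun i hi => ?_⟩
      refine step hK hmin (ext_mem' hJ.1 hJ.2.2 hβ)
        (t₀ := ⟨3 / 4, by norm_num, by norm_num⟩) (fun l => ?_) ?_
      · rw [ext_apply, rep_big (by norm_num), hβ.2.2.1]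
        rcases hJ.1 l with h | h
        · simp [toR, h]
        · simp [toR, h]; norm_num
      · rw [ext_apply, rep_big (by norm_num), hβ.2.2.1]
        simp [toR, hi]; norm_num; linarith
    apply isPreconnected_of_forall_pair
    intro γ hγ γ' hγ'
    suffices Rel P γ γ' by
      obtain ⟨S, h1, h2, h3, h4⟩ := this
      exact ⟨S, h1, h2, h3, h4⟩
    obtain ⟨i, hi, α, hα, hγα⟩ := htype γ hγ
    obtain ⟨k, hk, β, hβ, hγβ⟩ := htype γ' hγ'
    let A : Set (Fin n) := {m | ∀ δ ∈ DipathSpace K (toR w) (toR (v - Pi.single m 1)),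
      Rel P γ (ext (toR (Pi.single m 1)) δ)}
    have hiA : i ∈ A := fun δ hδ => hγα.trans (hrel i hi α hα δ hδ)
    by_cases hkA : k ∈ A
    · exact (hkA β hβ).trans hγβ.symm
    · exfalso
      obtain ⟨J, hJ, a, ha, b, hb, hJa, hJb⟩ := hconn v hv A i hiA k hkA hi hk
      obtain ⟨δ, hδ, hδ'⟩ := hcross J hJ
      obtain ⟨H, hH, hH'⟩ := hδ' a hJa
      obtain ⟨H2, hH2, hH2'⟩ := hδ' b hJb
      exact hb fun ε hε => (ha H hH).trans (hH'.symm.trans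
        (hH2'.trans (hrel b (single_mem_pastlk hJ hJb) H2 hH2 ε hε)))

theorem preconn_iff_conn {n : ℕ} {K : Set (Fin n → ℝ)} (hK : Cub K) {w : Fin n → ℤ}
    (hmin : ∀ q ∈ K, toR w ≤ q)
    (hreach : ∀ v : Fin n → ℤ, toR v ∈ K → (DipathSpace K (toR w) (toR v)).Nonempty) :
    (∀ v : Fin n → ℤ, toR v ∈ K → IsPreconnected (DipathSpace K (toR w) (toR v))) ↔
    (∀ v : Fin n → ℤ, toR v ∈ K → Conn K v) :=
  ⟨fun h v hv => conn_of_preconn hK hmin hreach (h v hv),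
    fun h v hv => preconn_of_conn hK hmin hreach h (∑ l, (v l - w l)).toNat v hv
      (Int.self_le_toNat _)⟩

/-- Past link connectivity in terms of the geometric realization. -/
theorem conn_of_geom {n : ℕ} {K : Set (Fin n → ℝ)} {v : Fin n → ℤ}
    (h : IsPreconnected (geomReal K v)) : Conn K v := by
  classical
  intro A i hi k hk hip hkp
  by_contra! hcon
  let f : (Fin n → ℝ) → ℝ := fun x => ∑ l, (if l ∈ A then (v l - x l) else 0)
  have hf : Continuous f := by
    refine continuous_finsetSum _ fun l _ => ?_
    split_ifs <;> fun_prop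
  have hfv : ∀ m, f (toR v - Pi.single m (1 : ℝ)) = if m ∈ A then 1 else 0 := by
    intro m
    have : ∀ l, (if l ∈ A then ((v l : ℝ) - (toR v - Pi.single m (1 : ℝ) : Fin n → ℝ) l) else 0)
        = if l = m then (if m ∈ A then 1 else 0) else 0 := by
      intro l
      by_cases hl : l = m
      · subst hl; simp [toR]
      · simp [toR, hl]
    simp only [f, this]
    simp
  have hconv : ∀ r : ℝ, Convex ℝ {x | f x = r} := by
    intro r x hx y hy a b ha hb hab
    simp only [mem_ofPred_eq] at hx hy ⊢
    have : f (a • x + b • y) = a * f x + b * f y := by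
      simp only [f, Finset.mul_sum, ← Finset.sum_add_distrib]
      refine Finset.sum_congr rfl fun l _ => ?_
      split_ifs
      · simp only [Pi.add_apply, Pi.smul_apply, smul_eq_mul]
        linear_combination (-(v l : ℝ)) * hab
      · simp
    rw [this, hx, hy, ← add_mul, hab, one_mul]
  have hval : ∀ x ∈ geomReal K v, f x = 0 ∨ f x = 1 := by
    intro x hx
    simp only [geomReal, mem_iUnion] at hx
    obtain ⟨J, hJ, hx⟩ := hx
    by_cases hA : ∃ a ∈ A, J a = 1
    · obtain ⟨a, ha, hJa⟩ := hA
      right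
      refine convexHull_min ?_ (hconv 1) hx
      rintro _ ⟨m, hm, rfl⟩
      have : m ∈ A := by
        by_contra hmA
        exact hcon J hJ a ha m hmA hJa hm
      simp [hfv, this]
    · left
      refine convexHull_min ?_ (hconv 0) hx
      rintro _ ⟨m, hm, rfl⟩
      have : m ∉ A := fun hmA => hA ⟨m, hmA, hm⟩
      simp [hfv, this]
  have hmem : ∀ m, Pi.single m 1 ∈ pastlk K v → toR v - Pi.single m (1 : ℝ) ∈ geomReal K v := by
    intro m hm
    simp only [geomReal, mem_iUnion]
    exact ⟨_, hm, subset_convexHull _ _ ⟨m, by simp, rfl⟩⟩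
  have himg := (h.image f hf.continuousOn).ordConnected.out
    ⟨_, hmem k hkp, rfl⟩ ⟨_, hmem i hip, rfl⟩
  rw [hfv, hfv, if_neg hk, if_pos hi] at himg
  obtain ⟨x, hx, hx'⟩ := himg (show (1 / 2 : ℝ) ∈ _ by norm_num)
  rcases hval x hx with h | h <;> rw [h] at hx' <;> norm_num at hx'

theorem geom_of_conn {n : ℕ} {K : Set (Fin n → ℝ)} {v : Fin n → ℤ}
    (h : Conn K v) : IsPreconnected (geomReal K v) := by
  unfold geomReal
  set s : (Fin n → ℤ) → Set (Fin n → ℝ) := fun j =>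
    convexHull ℝ ((fun i => toR v - Pi.single i (1 : ℝ)) '' {i | j i = 1}) with hs
  have hmem : ∀ j i, j i = 1 → toR v - Pi.single i (1 : ℝ) ∈ s j := fun j i hi =>
    subset_convexHull _ _ ⟨i, hi, rfl⟩
  have hadj : ∀ j i, j i = 1 → (s j ∩ s (Pi.single i 1)).Nonempty := fun j i hi =>
    ⟨_, hmem j i hi, hmem _ i (by simp)⟩
  apply IsPreconnected.biUnion_of_reflTransGen
  · intro j _
    exact (convex_convexHull ℝ _).isPreconnected
  · intro j hj j' hj'
    obtain ⟨i, hi⟩ := exists_one hj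
    obtain ⟨k, hk⟩ := exists_one hj'
    set R := fun a b : Fin n → ℤ => (s a ∩ s b).Nonempty ∧ a ∈ pastlk K v
    let A : Set (Fin n) := {m | Relation.ReflTransGen R j (Pi.single m 1)}
    have hiA : i ∈ A := Relation.ReflTransGen.single ⟨hadj j i hi, hj⟩
    by_cases hkA : k ∈ A
    · refine Relation.ReflTransGen.tail hkA ⟨?_, single_mem_pastlk hj' hk⟩
      rw [inter_comm]; exact hadj j' k hk
    · exfalso
      obtain ⟨J, hJ, a, ha, b, hb, hJa, hJb⟩ :=
        h A i hiA k hkA (single_mem_pastlk hj hi) (single_mem_pastlk hj' hk)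
      apply hb
      refine Relation.ReflTransGen.tail (Relation.ReflTransGen.tail ha (b := Pi.single a 1) (c := J)
        ⟨?_, single_mem_pastlk hJ hJa⟩) ⟨hadj J b hJb, hJ⟩
      rw [inter_comm]; exact hadj J a hJa

theorem preconn_of_hequiv {X Y : Type*} [TopologicalSpace X] [TopologicalSpace Y]
    (e : ContinuousMap.HomotopyEquiv X Y) (h : PreconnectedSpace X) : PreconnectedSpace Y := by
  have key : ∀ y : Y, connectedComponent (e.toFun (e.invFun y)) = connectedComponent y := by
    intro y
    obtain ⟨F⟩ := e.right_inv
    have hc : IsPreconnected (Set.range fun t : unitInterval => F (t, y)) :=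
      isPreconnected_range (by fun_prop)
    have := hc.subset_connectedComponent (x := y) ⟨1, by simp⟩
      (show e.toFun (e.invFun y) ∈ _ from ⟨0, by simp⟩)
    exact connectedComponent_eq this |>.symm
  constructor
  apply isPreconnected_of_forall_pair
  intro a _ b _
  refine ⟨connectedComponent a, subset_univ _, mem_connectedComponent, ?_,
    isPreconnected_connectedComponent⟩
  rw [← key a]
  have : e.toFun (e.invFun b) ∈ connectedComponent (e.toFun (e.invFun a)) :=
    (isPreconnected_range e.toFun.continuous).subset_connectedComponent ⟨_, rfl⟩ ⟨_, rfl⟩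
  rw [connectedComponent_eq this, key b]
  exact mem_connectedComponent

/-! ### Complexes, reachable complexes and collapses -/

theorem cube_cub {n : ℕ} {v j : Fin n → ℤ} {x : Fin n → ℝ} (hx : x ∈ cube v j) :
    Set.Icc (toR (fl x)) (toR (ce x)) ⊆ cube v j := by
  apply Set.Icc_subset_Icc
  · exact toR_mono fun l => Int.le_floor.2 (hx.1 l)
  · exact toR_mono fun l => Int.ceil_le.2 (hx.2 l)

theorem cub_of_isComplex {n : ℕ} {K : Set (Fin n → ℝ)} (hK : IsComplex K) : Cub K := by
  obtain ⟨C, -, rfl⟩ := hK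
  intro x hx
  simp only [mem_iUnion] at hx
  obtain ⟨c, hc, hx⟩ := hx
  exact (cube_cub hx).trans (subset_biUnion_of_mem (u := fun c => cube c.1 c.2) hc)

theorem cub_collapse {n : ℕ} (K τ : Set (Fin n → ℝ)) : Cub (collapse K τ) := by
  rintro x ⟨γ, hγ, hx⟩
  obtain ⟨v, j, hj, rfl⟩ := hγ.1
  exact (cube_cub hx).trans (subset_sUnion_of_mem hγ)

theorem collapse_subset {n : ℕ} (K τ : Set (Fin n → ℝ)) : collapse K τ ⊆ K :=
  sUnion_subset fun _ h => h.2.1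

theorem cub_reach {n : ℕ} {K : Set (Fin n → ℝ)} (hK : Cub K) {w : Fin n → ℤ} 
    : Cub (reach K (toR w)) := by
  rintro x ⟨hx, γ, hγ⟩ y hy
  refine ⟨hK x hx hy, ?_⟩
  let β : C(unitInterval, Fin n → ℝ) := ⟨fun t l => min (γ t l) (toR (fl x) l), by fun_prop⟩
  have hβ : ∀ t l, β t l = min (γ t l) ⌊x l⌋ := fun _ _ => rfl
  have hβP : β ∈ DipathSpace K (toR w) (toR (fl x)) := by
    refine ⟨fun t => ?_, ?_, ?_, ?_⟩
    · refine hK _ (hγ.1 t) ⟨fun l => ?_, fun l => ?_⟩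
      · rw [hβ]
        refine le_min (Int.floor_le _) ?_
        simp only [toR, fl]
        exact_mod_cast Int.floor_le_floor (path_le hγ t l)
      · exact (min_le_left _ _).trans (Int.le_ceil _)
    · ext l
      rw [hβ, hγ.2.1]
      apply min_eq_left
      have : toR w ≤ x := by rw [← hγ.2.1]; exact path_le hγ 0
      simp only [toR]
      exact_mod_cast Int.le_floor.2 (this l)
    · ext l
      rw [hβ, hγ.2.2.1]
      exact min_eq_right (Int.floor_le _)
    · intro s t hst l
      rw [hβ, hβ]
      exact min_le_min_right _ (hγ.2.2.2 hst l)
  refine ⟨_, ext_mem (sub_nonneg.2 hy.1) (add_sub_cancel _ _) ?_ hβP⟩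
  exact (Set.Icc_subset_Icc_right hy.2).trans (hK x hx)

theorem reach_reach {n : ℕ} {K : Set (Fin n → ℝ)} {p q : Fin n → ℝ} (h : q ∈ reach K p) :
    (DipathSpace (reach K p) p q).Nonempty := by
  obtain ⟨-, γ, hγ⟩ := h
  refine ⟨γ, fun t => ⟨hγ.1 t, ?_⟩, hγ.2⟩
  let m : C(unitInterval, unitInterval) := ⟨fun s => s * t, by fun_prop⟩
  have hm : ∀ s, m s = s * t := fun _ => rfl
  refine ⟨γ.comp m, fun s => hγ.1 _, ?_, ?_, ?_⟩
  · simp [hm, hγ.2.1]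
  · simp [hm]
  · intro a b hab
    apply hγ.2.2.2
    rw [hm, hm, ← Subtype.coe_le_coe]
    have h1 : (a : ℝ) ≤ b := hab
    have h2 : (0 : ℝ) ≤ t := t.2.1
    push_cast
    gcongr

theorem cube_subset_iff {n : ℕ} {v j v' j' : Fin n → ℤ} (hj : IsBinary j) :
    cube v j ⊆ cube v' j' ↔ v' - j' ≤ v - j ∧ v ≤ v' := by
  have h : v - j ≤ v := fun l => by
    rcases hj l with h | h <;> simp [h]
  rw [cube, cube, Set.Icc_subset_Icc_iff (toR_mono h)]
  exact ⟨fun h => ⟨le_of_toR h.1, le_of_toR h.2⟩, fun h => ⟨toR_mono h.1, toR_mono h.2⟩⟩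

theorem exists_maximal {n : ℕ} {K : Set (Fin n → ℝ)} (N : ℕ) : ∀ {v j : Fin n → ℤ}
    (_ : IsBinary j) (_ : cube v j ⊆ K) (_ : (n : ℤ) - ∑ l, j l ≤ N),
    ∃ γ, IsMaximalCube K γ ∧ cube v j ⊆ γ := by
  have hle : ∀ j : Fin n → ℤ, IsBinary j → ∑ l, j l ≤ n := by
    intro j hj
    have : ∑ l, j l ≤ ∑ _l : Fin n, (1 : ℤ) := Finset.sum_le_sum fun l _ => by
      rcases hj l with h | h <;> simp [h]
    simpa using this
  have hlt : ∀ v j v' j' : Fin n → ℤ, IsBinary j → cube v j ⊆ cube v' j' → cube v' j' ≠ cube v j →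
      ∑ l, j l < ∑ l, j' l := by
    intro v j v' j' hj hsub hne
    rw [cube_subset_iff hj] at hsub
    have h1 : ∀ l, j l ≤ j' l := fun l => by
      have := hsub.1 l
      have := hsub.2 l
      simp only [Pi.sub_apply] at *
      omega
    by_contra hcon
    have heq : ∑ l, j l = ∑ l, j' l :=
      le_antisymm (Finset.sum_le_sum fun l _ => h1 l) (not_lt.1 hcon)
    have h2 := (Finset.sum_eq_sum_iff_of_le fun l _ => h1 l).1 heq
    apply hne
    have hj : j' = j := funext fun l => (h2 l (Finset.mem_univ l)).symm
    have hv : v' = v := funext fun l => by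
      have := hsub.1 l
      have := hsub.2 l
      simp only [Pi.sub_apply, hj] at *
      omega
    rw [hj, hv]
  induction N with
  | zero =>
    intro v j hj hsub hN
    refine ⟨_, ⟨⟨v, j, hj, rfl⟩, hsub, ?_⟩, subset_rfl⟩
    rintro _ ⟨v', j', hj', rfl⟩ - h
    by_contra hne
    have := hlt v j v' j' hj h hne
    have := hle j' hj'
    push_cast at hN
    omega
  | succ N ih =>
    intro v j hj hsub hN
    by_cases hmax : IsMaximalCube K (cube v j)
    · exact ⟨_, hmax, subset_rfl⟩
    · have : ∃ γ, IsElemCube γ ∧ γ ⊆ K ∧ cube v j ⊆ γ ∧ γ ≠ cube v j := by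
        by_contra! hcon
        exact hmax ⟨⟨v, j, hj, rfl⟩, hsub, hcon⟩
      obtain ⟨_, ⟨v', j', hj', rfl⟩, h1, h2, h3⟩ := this
      have := hlt v j v' j' hj h2 h3
      obtain ⟨γ, hγ, hγ'⟩ := ih hj' h1 (by push_cast at hN; omega)
      exact ⟨γ, hγ, h2.trans hγ'⟩

/-- The past link at a vertex removed by the collapse is a simplex. -/
theorem conn_removed {n : ℕ} {K : Set (Fin n → ℝ)} {vτ jτ vσ jσ : Fin n → ℤ}
    (hjτ : IsBinary jτ) (hfree : IsFreeFace K (cube vτ jτ) (cube vσ jσ))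
    {v : Fin n → ℤ} (hv : toR v ∈ K) (hv' : toR v ∉ collapse K (cube vτ jτ)) : Conn K v := by
  intro A i hi k hk hip hkp
  have hpt : cube v 0 = {toR v} := by simp [cube]
  have hτ : cube vτ jτ ⊆ {toR v} := by
    by_contra hcon
    exact hv' ⟨{toR v}, ⟨⟨v, 0, fun _ => Or.inl rfl, hpt.symm⟩, by simpa using hv, hcon⟩, rfl⟩
  have hσ : ∀ m, Pi.single m 1 ∈ pastlk K v → cube v (Pi.single m 1) ⊆ cube vσ jσ := by
    intro m hm
    obtain ⟨γ, hγ, hsub⟩ := exists_maximal (K := K) (n + 0) hm.1 hm.2.2 (by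
      have : 0 ≤ ∑ l, (Pi.single m 1 : Fin n → ℤ) l := by simp
      push_cast; omega)
    have : γ = cube vσ jσ := by
      refine hfree.2.2.2 γ hγ (hτ.trans ?_)
      rw [singleton_subset_iff]
      apply hsub
      rw [← toR_sub_add v (Pi.single m 1)]
      refine ⟨le_add_of_nonneg_right (toR_nonneg hm.1), ?_⟩
      rw [toR_sub_add]
    exact this ▸ hsub
  have hi' := (cube_subset_iff (isBinary_single i)).1 (hσ i hip)
  have hk' := (cube_subset_iff (isBinary_single k)).1 (hσ k hkp)
  have hik : i ≠ k := fun h => hk (h ▸ hi)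
  have hbin : IsBinary (Pi.single i 1 + Pi.single k 1 : Fin n → ℤ) := by
    intro l
    by_cases h1 : l = i
    · subst h1; simp [hik]
    · by_cases h2 : l = k
      · subst h2; simp [h1]
      · simp [h1, h2]
  have e1 : (Pi.single i 1 + Pi.single k 1 : Fin n → ℤ) i = 1 := by simp [hik]
  have e2 : (Pi.single i 1 + Pi.single k 1 : Fin n → ℤ) k = 1 := by simp [hik.symm]
  refine ⟨Pi.single i 1 + Pi.single k 1, ⟨hbin, fun h => ?_, ?_⟩, i, hi, k, hk, e1, e2⟩
  · rw [h] at e1; simp at e1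
  · refine subset_trans ?_ hfree.2.2.1.2.1
    rw [cube_subset_iff hbin]
    refine ⟨fun l => ?_, hi'.2⟩
    have h1 := hi'.1 l
    have h2 := hk'.1 l
    by_cases h : l = i
    · subst h; simpa [hik] using h1
    · simpa [h] using h2

theorem reach_collapse {n : ℕ} {L τ : Set (Fin n → ℝ)} (hL : Cub L) {w : Fin n → ℤ}
    (hmin : ∀ q ∈ L, toR w ≤ q)
    (hreach : ∀ v : Fin n → ℤ, toR v ∈ L → (DipathSpace L (toR w) (toR v)).Nonempty)
    (hlpdc : IsLPDCPair L τ) (N : ℕ) :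
    ∀ v : Fin n → ℤ, toR v ∈ collapse L τ → ∑ l, (v l - w l) < N →
      (DipathSpace (collapse L τ) (toR w) (toR v)).Nonempty := by
  induction N with
  | zero =>
    intro v hv hN
    exfalso
    have hwv : w ≤ v := le_of_toR (hmin _ (collapse_subset _ _ hv))
    have : 0 ≤ ∑ l, (v l - w l) := Finset.sum_nonneg fun l _ => sub_nonneg.2 (hwv l)
    push_cast at hN
    omega
  | succ N ih =>
    intro v hv hN
    by_cases hne : w = v
    · subst hne
      exact ⟨ContinuousMap.const _ (toR w), fun _ => hv, rfl, rfl, fun _ _ _ => le_rfl⟩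
    · obtain ⟨J, hJ⟩ := exists_pastlk hL hne (hreach v (collapse_subset _ _ hv))
      obtain ⟨e⟩ := hlpdc v hv
      obtain ⟨i, hi⟩ := exists_one hJ
      have hx : toR v - Pi.single i (1 : ℝ) ∈ geomReal L v := by
        simp only [geomReal, mem_iUnion]
        exact ⟨J, hJ, subset_convexHull _ _ ⟨i, hi, rfl⟩⟩
      have hy := (e ⟨_, hx⟩).2
      simp only [geomReal, mem_iUnion] at hy
      obtain ⟨J', hJ', -⟩ := hy
      obtain ⟨k, hk⟩ := exists_one hJ'
      have hk' := single_mem_pastlk hJ' hk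
      obtain ⟨β, hβ⟩ := ih (v - Pi.single k 1) (bot_mem hk') (by
        have : ∑ l, ((v - Pi.single k 1 : Fin n → ℤ) l - w l) = ∑ l, (v l - w l) - 1 := by
          simp [Finset.sum_sub_distrib, Pi.single_apply]; ring
        rw [this]; push_cast at hN; omega)
      exact ⟨_, ext_mem' hk'.1 hk'.2.2 hβ⟩

theorem statement18 (n : ℕ) (hn : 0 < n) (K : Set (Fin n → ℝ)) (hK : IsComplex K)
    (w : Fin n → ℤ) (hw : toR w ∈ K) (hmin : ∀ q ∈ K, toR w ≤ q)
    (vτ jτ vσ jσ : Fin n → ℤ) (hjτ : IsBinary jτ) (hjσ : IsBinary jσ)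
    (hτL : cube vτ jτ ⊆ reach K (toR w)) (hσL : cube vσ jσ ⊆ reach K (toR w))
    (hfree : IsFreeFace (reach K (toR w)) (cube vτ jτ) (cube vσ jσ))
    (hlpdc : IsLPDCPair (reach K (toR w)) (cube vτ jτ)) :
    (∀ v : Fin n → ℤ, toR v ∈ reach K (toR w) →
        IsPreconnected (DipathSpace (reach K (toR w)) (toR w) (toR v))) ↔
    (∀ v : Fin n → ℤ, toR v ∈ collapse (reach K (toR w)) (cube vτ jτ) →
        IsPreconnected
          (DipathSpace (collapse (reach K (toR w)) (cube vτ jτ)) (toR w) (toR v))) := by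
  have hcub : Cub (reach K (toR w)) := cub_reach (cub_of_isComplex hK)
  have hcub' := cub_collapse (reach K (toR w)) (cube vτ jτ)
  have hminL : ∀ q ∈ reach K (toR w), toR w ≤ q := fun q hq => hmin q hq.1
  have hreachL : ∀ v : Fin n → ℤ, toR v ∈ reach K (toR w) →
      (DipathSpace (reach K (toR w)) (toR w) (toR v)).Nonempty := fun v hv => reach_reach hv
  have hsub := collapse_subset (reach K (toR w)) (cube vτ jτ)
  rw [preconn_iff_conn hcub hminL hreachL,
    preconn_iff_conn hcub' (fun q hq => hminL q (hsub hq)) (fun v hv =>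
      reach_collapse hcub hminL hreachL hlpdc ((∑ l, (v l - w l)).toNat + 1) v hv (by
        have := Int.self_le_toNat (∑ l, (v l - w l))
        push_cast; omega))]
  constructor
  · intro h v hv
    obtain ⟨e⟩ := hlpdc v hv
    apply conn_of_geom
    rw [isPreconnected_iff_preconnectedSpace]
    exact preconn_of_hequiv e (isPreconnected_iff_preconnectedSpace.1 (geom_of_conn (h v (hsub hv))))
  · intro h v hv
    by_cases hv' : toR v ∈ collapse (reach K (toR w)) (cube vτ jτ)
    · obtain ⟨e⟩ := hlpdc v hv'
      apply conn_of_geom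
      rw [isPreconnected_iff_preconnectedSpace]
      exact preconn_of_hequiv e.symm
        (isPreconnected_iff_preconnectedSpace.1 (geom_of_conn (h v hv')))
    · exact conn_removed hjτ hfree hv hv'

end DCC
end

section
/- Let K' := { x ∈ [0,1]⁴ : x₁ = 0 or x₂ = 0 or x₃ = 1 or x₄ = 1 } ⊆ ℝ⁴; this is the (τ, σ)-collapse of the standard unit 4-cube [0,1]⁴, where σ = [0,1]⁴ and τ is the vertex (1,1,0,0). Then there is no function f : [0,1]⁴ → [0,1]⁴ that is monotone with respect to the product order (i.e., x ⪯ y implies f(x) ⪯ f(y)), has image contained in K', and satisfies f(x) = x for all x ∈ K'. In particular, there is no directed retraction of the directed unit 4-cube onto its (τ, σ)-collapse. -/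
open Set

namespace DCC

theorem statement19 :
    ¬ ∃ f : (Fin 4 → ℝ) → (Fin 4 → ℝ),
      (∀ x ∈ Set.Icc (0 : Fin 4 → ℝ) 1, ∀ y ∈ Set.Icc (0 : Fin 4 → ℝ) 1,
          x ≤ y → f x ≤ f y) ∧
      (∀ x ∈ Set.Icc (0 : Fin 4 → ℝ) 1,
          f x ∈ {x : Fin 4 → ℝ |
            x ∈ Set.Icc (0 : Fin 4 → ℝ) 1 ∧ (x 0 = 0 ∨ x 1 = 0 ∨ x 2 = 1 ∨ x 3 = 1)}) ∧
      (∀ x ∈ {x : Fin 4 → ℝ |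
            x ∈ Set.Icc (0 : Fin 4 → ℝ) 1 ∧ (x 0 = 0 ∨ x 1 = 0 ∨ x 2 = 1 ∨ x 3 = 1)},
          f x = x) := by
  rintro ⟨f, hm, hK, hfix⟩
  have cu : ∀ a b c d : ℝ, 0 ≤ a → a ≤ 1 → 0 ≤ b → b ≤ 1 → 0 ≤ c → c ≤ 1 → 0 ≤ d → d ≤ 1 →
      (![a, b, c, d] : Fin 4 → ℝ) ∈ Set.Icc (0 : Fin 4 → ℝ) 1 := by
    intro a b c d _ _ _ _ _ _ _ _
    constructor <;> intro i <;> fin_cases i <;> simpa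
  have hp := cu 1 1 0 0 (by simp) (by simp) (by simp) (by simp) (by simp) (by simp) (by simp) (by simp)
  have h1 := cu 1 0 0 0 (by simp) (by simp) (by simp) (by simp) (by simp) (by simp) (by simp) (by simp)
  have h2 := cu 0 1 0 0 (by simp) (by simp) (by simp) (by simp) (by simp) (by simp) (by simp) (by simp)
  have h3 := cu 1 1 1 0 (by simp) (by simp) (by simp) (by simp) (by simp) (by simp) (by simp) (by simp)
  have h4 := cu 1 1 0 1 (by simp) (by simp) (by simp) (by simp) (by simp) (by simp) (by simp) (by simp)
  have g1 := hm _ h1 _ hp (by intro i; fin_cases i <;> simp) 0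
  have g2 := hm _ h2 _ hp (by intro i; fin_cases i <;> simp) 1
  have g3 := hm _ hp _ h3 (by intro i; fin_cases i <;> simp) 3
  have g4 := hm _ hp _ h4 (by intro i; fin_cases i <;> simp) 2
  rw [hfix _ ⟨h1, by simp⟩] at g1
  rw [hfix _ ⟨h2, by simp⟩] at g2
  rw [hfix _ ⟨h3, by simp⟩] at g3
  rw [hfix _ ⟨h4, by simp⟩] at g4
  simp at g1 g2 g3 g4
  rcases (hK _ hp).2 with h | h | h | h <;> linarith

end DCC
end
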